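/- arXiv:1505.06534 — 3 statements merged into one kernel-verified Lean document; each statement's English description precedes it below -/
import Mathlib

section
/- For every multi-index k ∈ ℕ^d and every x ∈ ℝ^d, P_k(A,ℏ,x) = exp( ‖|A|⁻¹x‖²/ℏ ) · ( D_1^{k_1} ∘ ⋯ ∘ D_d^{k_d} ) [ y ↦ exp( −‖|A|⁻¹y‖²/ℏ ) ](x), where for 1 ≤ l ≤ d the first-order differential operator D_l is defined by D_l f = −√ℏ · Σ_{j=1}^d conj(A_{j l}) ∂f/∂x_j (i.e. D_l = −√ℏ times the l-th component of A*∇, and the operators D_1, …, D_d commute), and ‖·‖ is the Euclidean norm on ℝ^d. -/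
open Matrix Complex

noncomputable section

/-- The pairing `⟨a, b⟩ = ∑ j, conj (a j) * b j` on `ℂ^d`. -/
def cinner {d : ℕ} (a b : Fin d → ℂ) : ℂ := ∑ j, (starRingEnd ℂ) (a j) * b j

/-- The embedding of `ℝ^d` into `ℂ^d`. -/
def cvec {d : ℕ} (x : Fin d → ℝ) : Fin d → ℂ := fun j => (x j : ℂ)

/-- The `l`-th standard basis vector of `ℂ^d`. -/
def stdC {d : ℕ} (l : Fin d) : Fin d → ℂ := Pi.single l 1

/-- The gradient of `ψ : ℝ^d → ℂ`, viewed as the vector of partial derivatives. -/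
def grad {d : ℕ} (ψ : (Fin d → ℝ) → ℂ) (x : Fin d → ℝ) : Fin d → ℂ :=
  fun j => fderiv ℝ ψ x (Pi.single j 1)

/-- The raising operator `R_l` built from `(A, B)` at semiclassical parameter `h`. -/
def raiseOp {d : ℕ} (A B : Matrix (Fin d) (Fin d) ℂ) (h : ℝ) (l : Fin d)
    (ψ : (Fin d → ℝ) → ℂ) : (Fin d → ℝ) → ℂ := fun x =>
  ((Real.sqrt (2 * h) : ℝ) : ℂ)⁻¹ *
    (cinner (B.mulVec (stdC l)) (cvec x) * ψ x
      - (h : ℂ) * cinner (A.mulVec (stdC l)) (grad ψ x))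

/-- The ground state Gaussian `φ₀`, where `sqrtA` is a fixed branch of `√(det A)`. -/
def phi0 {d : ℕ} (A B : Matrix (Fin d) (Fin d) ℂ) (h : ℝ) (sqrtA : ℂ)
    (x : Fin d → ℝ) : ℂ :=
  ((Real.pi ^ (-(d : ℝ) / 4) * h ^ (-(d : ℝ) / 4) : ℝ) : ℂ) * sqrtA⁻¹ *
    Complex.exp (-(cinner (cvec x) ((B * A⁻¹).mulVec (cvec x)) / ((2 * h : ℝ) : ℂ)))

/-- `R_1^{k_1} ∘ ⋯ ∘ R_d^{k_d}` for a family of operators `R` and a multi-index `k`. -/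
def opPow {d : ℕ} {α : Type*} (R : Fin d → (α → α)) (k : Fin d → ℕ) : α → α :=
  (List.finRange d).foldr (fun l f => (R l)^[k l] ∘ f) id

/-- The polynomials `P_k(A, h, x)`:
`P_k = 2^{|k|/2} (R_1^{k_1} ∘ ⋯ ∘ R_d^{k_d} φ₀)(x) / φ₀(x)`. -/
def Ppoly {d : ℕ} (A B : Matrix (Fin d) (Fin d) ℂ) (h : ℝ) (sqrtA : ℂ)
    (k : Fin d → ℕ) (x : Fin d → ℝ) : ℂ :=
  (((2 : ℝ) ^ (((∑ l, k l : ℕ) : ℝ) / 2) : ℝ) : ℂ) *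
    opPow (raiseOp A B h) k (phi0 A B h sqrtA) x / phi0 A B h sqrtA x

/-- The coordinate partial derivative `∂_j` acting on functions on `ℝ^d`. -/
def pdC {d : ℕ} (j : Fin d) (f : (Fin d → ℝ) → ℂ) : (Fin d → ℝ) → ℂ :=
  fun x => fderiv ℝ f x (Pi.single j 1)

/-- The generating function
`G(x,z) = exp(−⟨conj z, A⁻¹ conj(A) z⟩ + (2/√h) ⟨conj z, A⁻¹ x⟩)`. -/
def Gfun {d : ℕ} (A : Matrix (Fin d) (Fin d) ℂ) (h : ℝ) (x : Fin d → ℝ)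
    (z : Fin d → ℂ) : ℂ :=
  Complex.exp
    (-(cinner (fun j => (starRingEnd ℂ) (z j)) ((A⁻¹ * A.map (starRingEnd ℂ)).mulVec z))
      + (2 / ((Real.sqrt h : ℝ) : ℂ)) *
          cinner (fun j => (starRingEnd ℂ) (z j)) (A⁻¹.mulVec (cvec x)))

/-- The holomorphic partial derivative `∂/∂z_l` of a function on `ℂ^d`. -/
def dz {d : ℕ} (l : Fin d) (f : (Fin d → ℂ) → ℂ) : (Fin d → ℂ) → ℂ :=
  fun z => deriv (fun t => f (Function.update z l t)) (z l)


/-- The derivation `D_l = -√h (A* ∇)_l`. -/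
def rodriguesOp {d : ℕ} (A : Matrix (Fin d) (Fin d) ℂ) (h : ℝ) (l : Fin d)
    (f : (Fin d → ℝ) → ℂ) : (Fin d → ℝ) → ℂ := fun y =>
  -((Real.sqrt h : ℝ) : ℂ) * ∑ j, (starRingEnd ℂ) (A j l) * pdC j f y

/-- The complex quadratic form `x ↦ xᵗ N x` on `ℝ^d`. -/
def quadC {d : ℕ} (N : Matrix (Fin d) (Fin d) ℂ) (x : Fin d → ℝ) : ℂ :=
  cvec x ⬝ᵥ N *ᵥ cvec x

theorem cinner_mulVec_stdC {d : ℕ} (A : Matrix (Fin d) (Fin d) ℂ) (l : Fin d)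
    (u : Fin d → ℂ) : cinner (A *ᵥ stdC l) u = (Aᴴ *ᵥ u) l := by
  simp [cinner, stdC, mulVec, dotProduct, Pi.single_apply]

theorem cinner_cvec {d : ℕ} (x : Fin d → ℝ) (u : Fin d → ℂ) :
    cinner (cvec x) u = cvec x ⬝ᵥ u := by
  simp [cinner, cvec, dotProduct]

theorem rodriguesOp_eq_cinner {d : ℕ} (A : Matrix (Fin d) (Fin d) ℂ) (h : ℝ) (l : Fin d)
    (f : (Fin d → ℝ) → ℂ) (x : Fin d → ℝ) :
    rodriguesOp A h l f x = -((Real.sqrt h : ℝ) : ℂ) * cinner (A *ᵥ stdC l) (grad f x) := by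
  simp [rodriguesOp, cinner, stdC, pdC, grad]

theorem hasFDerivAt_cvec_apply {d : ℕ} (x : Fin d → ℝ) (i : Fin d) :
    HasFDerivAt (fun y : Fin d → ℝ => cvec y i)
      (Complex.ofRealCLM.comp (ContinuousLinearMap.proj (R := ℝ) (φ := fun _ => ℝ) i)) x :=
  (Complex.ofRealCLM.comp
    (ContinuousLinearMap.proj (R := ℝ) (φ := fun _ : Fin d => ℝ) i)).hasFDerivAt

theorem contDiff_quadC {d : ℕ} (N : Matrix (Fin d) (Fin d) ℂ) {n : WithTop ℕ∞} :
    ContDiff ℝ n (quadC N) := by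
  have hc : ∀ i, ContDiff ℝ n (fun y : Fin d → ℝ => cvec y i) := fun i =>
    (Complex.ofRealCLM.comp
      (ContinuousLinearMap.proj (R := ℝ) (φ := fun _ : Fin d => ℝ) i)).contDiff
  unfold quadC
  simp only [dotProduct, mulVec]
  exact ContDiff.sum fun i _ => (hc i).mul (ContDiff.sum fun j _ => contDiff_const.mul (hc j))

theorem grad_quadC {d : ℕ} {N : Matrix (Fin d) (Fin d) ℂ} (hN : N.IsSymm) (x : Fin d → ℝ) :
    grad (quadC N) x = (2 : ℂ) • (N *ᵥ cvec x) := by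
  ext k
  have hq : HasFDerivAt (quadC N) _ x := HasFDerivAt.fun_sum (u := Finset.univ) fun i _ =>
    (hasFDerivAt_cvec_apply x i).mul (HasFDerivAt.fun_sum (u := Finset.univ) fun j _ =>
      (hasFDerivAt_cvec_apply x j).const_mul (N i j))
  rw [grad, hq.fderiv]
  simp only [_root_.sum_apply, _root_.add_apply, _root_.smul_apply,
    ContinuousLinearMap.comp_apply, ContinuousLinearMap.proj_apply, Pi.single_apply,
    Complex.ofRealCLM_apply, Pi.smul_apply, smul_eq_mul, Finset.sum_add_distrib]
  have h1 : ∀ i, N i k = N k i := fun i => hN.apply k i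
  simp [apply_ite Complex.ofReal, mulVec, dotProduct, h1, mul_comm, two_mul]

theorem grad_mul {d : ℕ} {u f : (Fin d → ℝ) → ℂ} {x : Fin d → ℝ}
    (hu : DifferentiableAt ℝ u x) (hf : DifferentiableAt ℝ f x) :
    grad (fun y => u y * f y) x = u x • grad f x + f x • grad u x := by
  ext k
  simp [grad, fderiv_fun_mul hu hf]

theorem grad_cexp {d : ℕ} {q : (Fin d → ℝ) → ℂ} {x : Fin d → ℝ}
    (hq : DifferentiableAt ℝ q x) :
    grad (fun y => Complex.exp (q y)) x = Complex.exp (q x) • grad q x := by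
  ext k
  simp [grad, hq.hasFDerivAt.cexp.fderiv]

theorem contDiff_rodriguesOp {d : ℕ} (A : Matrix (Fin d) (Fin d) ℂ) (h : ℝ) (l : Fin d)
    {f : (Fin d → ℝ) → ℂ} (hf : ContDiff ℝ (⊤ : ℕ∞) f) :
    ContDiff ℝ (⊤ : ℕ∞) (rodriguesOp A h l f) := by
  unfold rodriguesOp pdC
  have h1 : ContDiff ℝ (⊤ : ℕ∞) (fderiv ℝ f) := hf.fderiv_right (by simp)
  exact contDiff_const.mul (ContDiff.sum fun j _ =>
    contDiff_const.mul (h1.clm_apply contDiff_const))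

/-- Conjugating by the Gaussian `exp(xᵗ N x / 2h)` with `A* N = B*` turns `√2 R_l` into `D_l`. -/
theorem raiseOp_gaussian_mul {d : ℕ} {A B N : Matrix (Fin d) (Fin d) ℂ} {h : ℝ} (hh : 0 < h)
    (hN : N.IsSymm) (hAN : Aᴴ * N = Bᴴ) (l : Fin d) (a : ℂ) {f : (Fin d → ℝ) → ℂ}
    (hf : Differentiable ℝ f) :
    raiseOp A B h l (fun y => a * Complex.exp ((2 * h : ℂ)⁻¹ * quadC N y) * f y) =
      fun y => a * ((Real.sqrt 2 : ℝ) : ℂ)⁻¹ * Complex.exp ((2 * h : ℂ)⁻¹ * quadC N y) *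
        rodriguesOp A h l f y := by
  ext x
  have hq : Differentiable ℝ (quadC N) :=
    (contDiff_quadC N (n := 1)).differentiable (by simp)
  have hcq : DifferentiableAt ℝ (fun y => (2 * h : ℂ)⁻¹ * quadC N y) x := (hq x).const_mul _
  have hg : grad (fun y => (2 * h : ℂ)⁻¹ * quadC N y) x =
      (2 * h : ℂ)⁻¹ • grad (quadC N) x := by
    ext k
    simp [grad, fderiv_const_mul (hq x)]
  have hv : DifferentiableAt ℝ (fun y => Complex.exp ((2 * h : ℂ)⁻¹ * quadC N y)) x := hcq.cexp
  have hav : grad (fun y => a * Complex.exp ((2 * h : ℂ)⁻¹ * quadC N y)) x =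
      a • grad (fun y => Complex.exp ((2 * h : ℂ)⁻¹ * quadC N y)) x := by
    ext k
    simp only [grad, fderiv_const_mul hv, _root_.smul_apply, Pi.smul_apply]
  rw [raiseOp, grad_mul (hv.const_mul a) (hf x), hav, grad_cexp hcq, hg, grad_quadC hN,
    rodriguesOp_eq_cinner]
  simp only [cinner_mulVec_stdC, mulVec_add, mulVec_smul, mulVec_mulVec, hAN, Pi.add_apply,
    Pi.smul_apply, smul_eq_mul]
  have h0 : (h : ℂ) ≠ 0 := by exact_mod_cast hh.ne'
  have hs0 : ((Real.sqrt h : ℝ) : ℂ) ≠ 0 := by exact_mod_cast (Real.sqrt_pos.2 hh).ne'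
  have h20 : ((Real.sqrt 2 : ℝ) : ℂ) ≠ 0 := by simp
  have hs : (h : ℂ) = ((Real.sqrt h : ℝ) : ℂ) * ((Real.sqrt h : ℝ) : ℂ) := by
    exact_mod_cast (Real.mul_self_sqrt hh.le).symm
  rw [Real.sqrt_mul (by norm_num), Complex.ofReal_mul]
  field_simp
  linear_combination
    (-(a * (Aᴴ *ᵥ grad f x) l)) * hs

theorem iterate_raiseOp_gaussian_mul {d : ℕ} {A B N : Matrix (Fin d) (Fin d) ℂ} {h : ℝ}
    (hh : 0 < h) (hN : N.IsSymm) (hAN : Aᴴ * N = Bᴴ) (l : Fin d) (n : ℕ) (a : ℂ)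
    {f : (Fin d → ℝ) → ℂ} (hf : ContDiff ℝ (⊤ : ℕ∞) f) :
    ContDiff ℝ (⊤ : ℕ∞) ((rodriguesOp A h l)^[n] f) ∧
    (raiseOp A B h l)^[n] (fun y => a * Complex.exp ((2 * h : ℂ)⁻¹ * quadC N y) * f y) =
      fun y => a * ((Real.sqrt 2 : ℝ) : ℂ)⁻¹ ^ n * Complex.exp ((2 * h : ℂ)⁻¹ * quadC N y) *
        (rodriguesOp A h l)^[n] f y := by
  induction n with
  | zero => simpa using hf
  | succ n ih =>
    simp only [Function.iterate_succ_apply']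
    refine ⟨contDiff_rodriguesOp A h l ih.1, ?_⟩
    rw [ih.2, raiseOp_gaussian_mul hh hN hAN l _ (ih.1.differentiable (by simp))]
    simp only [pow_succ, mul_assoc]

theorem opPow_raiseOp_gaussian_mul {d : ℕ} {A B N : Matrix (Fin d) (Fin d) ℂ} {h : ℝ}
    (hh : 0 < h) (hN : N.IsSymm) (hAN : Aᴴ * N = Bᴴ) (k : Fin d → ℕ) (a : ℂ)
    {f : (Fin d → ℝ) → ℂ} (hf : ContDiff ℝ (⊤ : ℕ∞) f) :
    opPow (raiseOp A B h) k (fun y => a * Complex.exp ((2 * h : ℂ)⁻¹ * quadC N y) * f y) =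
      fun y => a * ((Real.sqrt 2 : ℝ) : ℂ)⁻¹ ^ (∑ l, k l) *
        Complex.exp ((2 * h : ℂ)⁻¹ * quadC N y) * opPow (rodriguesOp A h) k f y := by
  rw [Fin.sum_univ_def]
  unfold opPow
  suffices H : ∀ L : List (Fin d),
      ContDiff ℝ (⊤ : ℕ∞) (L.foldr (fun l g => (rodriguesOp A h l)^[k l] ∘ g) id f) ∧
      L.foldr (fun l g => (raiseOp A B h l)^[k l] ∘ g) id
        (fun y => a * Complex.exp ((2 * h : ℂ)⁻¹ * quadC N y) * f y) =
      fun y => a * ((Real.sqrt 2 : ℝ) : ℂ)⁻¹ ^ (L.map k).sum *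
        Complex.exp ((2 * h : ℂ)⁻¹ * quadC N y) *
          L.foldr (fun l g => (rodriguesOp A h l)^[k l] ∘ g) id f y from (H _).2
  intro L
  induction L with
  | nil => simpa using hf
  | cons l L ih =>
    simp only [List.foldr_cons, Function.comp_apply, List.map_cons, List.sum_cons]
    have step := fun b => iterate_raiseOp_gaussian_mul (B := B) hh hN hAN l (k l) b ih.1
    refine ⟨(step 1).1, ?_⟩
    rw [ih.2, (step _).2]
    ext y
    ring

/-- `B A⁻¹` is symmetric when `Aᵗ B = Bᵗ A`. -/
theorem isSymm_mul_inv {d : ℕ} {A B : Matrix (Fin d) (Fin d) ℂ} (hA : IsUnit A.det)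
    (hAB : Aᵀ * B - Bᵀ * A = 0) : (B * A⁻¹).IsSymm := by
  have hAT : IsUnit Aᵀ.det := by rwa [det_transpose]
  rw [Matrix.IsSymm, transpose_mul, transpose_nonsing_inv]
  calc Aᵀ⁻¹ * Bᵀ = Aᵀ⁻¹ * (Bᵀ * A) * A⁻¹ := by
        rw [Matrix.mul_assoc, Matrix.mul_assoc, mul_nonsing_inv A hA, Matrix.mul_one]
    _ = B * A⁻¹ := by
        rw [← sub_eq_zero.1 hAB, ← Matrix.mul_assoc, nonsing_inv_mul _ hAT, Matrix.one_mul]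

/-- `B A⁻¹ + (B A⁻¹)* = 2 (A A*)⁻¹` when `A* B + B* A = 2`. -/
theorem mul_inv_add_conjTranspose {d : ℕ} {A B : Matrix (Fin d) (Fin d) ℂ} (hA : IsUnit A.det)
    (hAB : Aᴴ * B + Bᴴ * A = (2 : ℂ) • (1 : Matrix (Fin d) (Fin d) ℂ)) :
    B * A⁻¹ + (B * A⁻¹)ᴴ = (2 : ℂ) • (A * Aᴴ)⁻¹ := by
  have hAH : IsUnit Aᴴ.det := by rw [det_conjTranspose]; exact hA.star
  rw [conjTranspose_mul, conjTranspose_nonsing_inv, Matrix.mul_inv_rev]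
  calc B * A⁻¹ + Aᴴ⁻¹ * Bᴴ = Aᴴ⁻¹ * (Aᴴ * B + Bᴴ * A) * A⁻¹ := by
        rw [Matrix.mul_add, Matrix.add_mul, ← Matrix.mul_assoc, nonsing_inv_mul _ hAH,
          Matrix.one_mul, Matrix.mul_assoc _ (Bᴴ * A), Matrix.mul_assoc Bᴴ,
          mul_nonsing_inv A hA, Matrix.mul_one]
    _ = (2 : ℂ) • (Aᴴ⁻¹ * A⁻¹) := by rw [hAB]; simp

/-- `‖S⁻¹ x‖²` is the quadratic form of `(S S)⁻¹` for symmetric `S`. -/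
theorem ofReal_sum_sq_inv_mulVec {d : ℕ} {S : Matrix (Fin d) (Fin d) ℝ} (hS : S.IsSymm)
    (hu : IsUnit S.det) (x : Fin d → ℝ) :
    ((∑ j, (S⁻¹ *ᵥ x) j ^ 2 : ℝ) : ℂ) =
      quadC (S.map (fun t : ℝ => (t : ℂ)) * S.map (fun t : ℝ => (t : ℂ)))⁻¹ x := by
  have hinv : (S.map (fun t : ℝ => (t : ℂ)))⁻¹ = S⁻¹.map (fun t : ℝ => (t : ℂ)) := by
    refine inv_eq_right_inv ?_
    have := congrArg (fun T : Matrix (Fin d) (Fin d) ℝ => T.map Complex.ofRealHom)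
      (mul_nonsing_inv S hu)
    rw [Matrix.map_mul, Matrix.map_one _ (map_zero _) (map_one _)] at this
    exact this
  have hT : (S⁻¹.map (fun t : ℝ => (t : ℂ)))ᵀ = S⁻¹.map (fun t : ℝ => (t : ℂ)) := by
    rw [← transpose_map, transpose_nonsing_inv, hS.eq]
  have hv : S⁻¹.map (fun t : ℝ => (t : ℂ)) *ᵥ cvec x = cvec (S⁻¹ *ᵥ x) := by
    ext i
    simp [cvec, mulVec, dotProduct]
  rw [quadC, Matrix.mul_inv_rev, hinv, ← mulVec_mulVec, dotProduct_mulVec, ← mulVec_transpose,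
    hT, hv]
  simp [dotProduct, cvec, sq]

/-- Theorem 4.1 (Rodrigues formula):
`P_k(A,ℏ,x) = exp(‖|A|⁻¹x‖²/ℏ) · (D_1^{k_1} ∘ ⋯ ∘ D_d^{k_d})[y ↦ exp(−‖|A|⁻¹y‖²/ℏ)](x)`,
where `D_l f = −√ℏ ∑_j conj(A_{jl}) ∂f/∂x_j`, and `|A|` is the positive definite
square root of `A A*` (a real symmetric positive definite matrix `Sa`). -/
theorem rodrigues_formula
    {d : ℕ} (hd : 1 ≤ d) {hbar : ℝ} (hhbar : 0 < hbar)
    (A B : Matrix (Fin d) (Fin d) ℂ) (hA : IsUnit A.det) (hB : IsUnit B.det)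
    (hAB₁ : Aᴴ * B + Bᴴ * A = (2 : ℂ) • (1 : Matrix (Fin d) (Fin d) ℂ))
    (hAB₂ : Aᵀ * B - Bᵀ * A = 0)
    (sqrtA : ℂ) (hsqrtA : sqrtA ^ 2 = A.det)
    (Sa : Matrix (Fin d) (Fin d) ℝ) (hSa_symm : Sa.IsSymm) (hSa_pos : Sa.PosDef)
    (hSa_sq : (Sa.map (fun t : ℝ => (t : ℂ))) * (Sa.map (fun t : ℝ => (t : ℂ))) = A * Aᴴ)
    (k : Fin d → ℕ) (x : Fin d → ℝ) :
    Ppoly A B hbar sqrtA k x =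
      Complex.exp ((((∑ j, (Sa⁻¹.mulVec x j) ^ 2) / hbar : ℝ) : ℂ)) *
        opPow
          (fun l f => fun y =>
            -((Real.sqrt hbar : ℝ) : ℂ) * ∑ j, (starRingEnd ℂ) (A j l) * pdC j f y)
          k
          (fun y => Complex.exp (-(((∑ j, (Sa⁻¹.mulVec y j) ^ 2) / hbar : ℝ) : ℂ))) x := by
  set N : Matrix (Fin d) (Fin d) ℂ := (B * A⁻¹)ᴴ with hNdef
  have hN : N.IsSymm := (isSymm_mul_inv hA hAB₂).conjTranspose
  have hAN : Aᴴ * N = Bᴴ := by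
    rw [hNdef, ← conjTranspose_mul, Matrix.mul_assoc, nonsing_inv_mul A hA, Matrix.mul_one]
  have hh : (hbar : ℂ) ≠ 0 := by exact_mod_cast hhbar.ne'
  have hquad : ∀ y, quadC (B * A⁻¹) y + quadC N y =
      2 * ((∑ j, (Sa⁻¹.mulVec y j) ^ 2 : ℝ) : ℂ) := fun y => by
    rw [ofReal_sum_sq_inv_mulVec hSa_symm hSa_pos.det_pos.ne'.isUnit, hSa_sq, quadC, quadC, quadC,
      ← dotProduct_add, ← add_mulVec, mul_inv_add_conjTranspose hA hAB₁, smul_mulVec,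
      dotProduct_smul, smul_eq_mul]
  set c : ℂ := ((Real.pi ^ (-(d : ℝ) / 4) * hbar ^ (-(d : ℝ) / 4) : ℝ) : ℂ) * sqrtA⁻¹ with hc
  have hs0 : sqrtA ≠ 0 := by
    rintro rfl
    exact hA.ne_zero (by rw [← hsqrtA]; simp)
  have hc0 : c ≠ 0 := mul_ne_zero (by
    rw [Complex.ofReal_ne_zero]
    positivity) (inv_ne_zero hs0)
  set g : (Fin d → ℝ) → ℂ :=
    fun y => Complex.exp (-(((∑ j, (Sa⁻¹.mulVec y j) ^ 2) / hbar : ℝ) : ℂ)) with hgdef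
  have hg : ContDiff ℝ (⊤ : ℕ∞) g := by
    have : g = fun y => Complex.exp (-(quadC (A * Aᴴ)⁻¹ y * (hbar : ℂ)⁻¹)) := by
      ext y
      simp only [hgdef]
      rw [← hSa_sq, ← ofReal_sum_sq_inv_mulVec hSa_symm hSa_pos.det_pos.ne'.isUnit,
        Complex.ofReal_div, div_eq_mul_inv]
    rw [this]
    exact ((contDiff_quadC _).mul contDiff_const).neg.cexp
  have hphi : phi0 A B hbar sqrtA =
      fun y => c * Complex.exp ((2 * hbar : ℂ)⁻¹ * quadC N y) * g y := by
    ext y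
    simp only [phi0, ← hc, hgdef]
    rw [mul_assoc c, ← Complex.exp_add, cinner_cvec]
    congr 2
    have := hquad y
    rw [quadC] at this
    rw [Complex.ofReal_div, eq_sub_of_add_eq this]
    push_cast
    field_simp
    ring
  change _ = _ * opPow (rodriguesOp A hbar) k g x
  have hpow : (((2 : ℝ) ^ (((∑ l, k l : ℕ) : ℝ) / 2) : ℝ) : ℂ) *
      ((Real.sqrt 2 : ℝ) : ℂ)⁻¹ ^ (∑ l, k l) = 1 := by
    rw [Real.sqrt_eq_rpow, inv_pow, ← Complex.ofReal_pow, ← Real.rpow_natCast,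
      ← Real.rpow_mul (by norm_num), one_div_mul_eq_div]
    refine mul_inv_cancel₀ ?_
    rw [Complex.ofReal_ne_zero]
    positivity
  have hginv : Complex.exp ((((∑ j, (Sa⁻¹.mulVec x j) ^ 2) / hbar : ℝ) : ℂ)) = (g x)⁻¹ := by
    rw [hgdef, ← Complex.exp_neg, neg_neg]
  have hgx : g x ≠ 0 := Complex.exp_ne_zero _
  rw [hginv, Ppoly, hphi, opPow_raiseOp_gaussian_mul hhbar hN hAN k c hg]
  have he := Complex.exp_ne_zero ((2 * hbar : ℂ)⁻¹ * quadC N x)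
  rw [div_eq_iff (mul_ne_zero (mul_ne_zero hc0 he) hgx), mul_right_comm _ _ (c * _ * _),
    inv_mul_eq_div, eq_comm, div_mul_eq_mul_div, div_eq_iff hgx]
  linear_combination (-(c * Complex.exp ((2 * hbar : ℂ)⁻¹ * quadC N x) * g x *
    opPow (rodriguesOp A hbar) k g x)) * hpow

end
end

section
/- For every Schwartz function ψ: ℝ^d → ℂ, every 1 ≤ l ≤ d, and every x ∈ ℝ^d, (R_l ψ)(x) = −√(ℏ/2) · (1 / conj(φ₀(x))) · ⟨ A e_l, ∇( conj(φ₀) · ψ )(x) ⟩, where conj(φ₀) denotes the pointwise complex conjugate of φ₀. -/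
open Matrix Complex

noncomputable section

/-- The coordinate functional `x ↦ x j` on `ℝ^d`, with values in `ℂ`. -/
def coordC {d : ℕ} (j : Fin d) : (Fin d → ℝ) →L[ℝ] ℂ :=
  Complex.ofRealCLM.comp (ContinuousLinearMap.proj (R := ℝ) (φ := fun _ : Fin d => ℝ) j)

lemma coordC_apply {d : ℕ} (j : Fin d) (v : Fin d → ℝ) : coordC j v = (v j : ℂ) := rfl

lemma cinner_cvec_mulVec {d : ℕ} (W : Matrix (Fin d) (Fin d) ℂ) (y : Fin d → ℝ) :
    cinner (cvec y) (W *ᵥ cvec y) = ∑ j, coordC j y * ∑ k, W j k * coordC k y := by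
  simp [cinner, cvec, mulVec, dotProduct, coordC_apply]

/-- The partial derivatives of a quadratic form with symmetric matrix. -/
lemma exists_hasFDerivAt_quadratic {d : ℕ} {W : Matrix (Fin d) (Fin d) ℂ} (hW : Wᵀ = W)
    (x : Fin d → ℝ) :
    ∃ L : (Fin d → ℝ) →L[ℝ] ℂ,
      HasFDerivAt (fun y => cinner (cvec y) (W *ᵥ cvec y)) L x ∧
        ∀ i, L (Pi.single i 1) = 2 * (W *ᵥ cvec x) i := by
  have hcoord : ∀ j : Fin d, HasFDerivAt (fun y => coordC j y) (coordC j) x :=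
    fun j => (coordC j).hasFDerivAt
  have hder := HasFDerivAt.fun_sum (u := Finset.univ) fun j _ =>
    (hcoord j).fun_mul (HasFDerivAt.fun_sum (u := Finset.univ) fun k _ => (hcoord k).const_mul (W j k))
  simp only [cinner_cvec_mulVec]
  refine ⟨_, hder, fun i => ?_⟩
  have hsymm : ∀ j, W j i = W i j := fun j => congrFun (congrFun hW i) j
  simp [coordC_apply, Pi.single_apply, apply_ite, Finset.sum_add_distrib, mulVec, dotProduct, cvec,
    hsymm, two_mul, mul_comm (x _ : ℂ)]

/-- The conjugated Gaussian is differentiable with `∇ conj(φ₀) = -ℏ⁻¹ conj(B A⁻¹ x) conj(φ₀)`. -/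
lemma exists_hasFDerivAt_conj_phi0 {d : ℕ} {A B : Matrix (Fin d) (Fin d) ℂ}
    (hW : (B * A⁻¹)ᵀ = B * A⁻¹) (h : ℝ) (sqrtA : ℂ) (x : Fin d → ℝ) :
    ∃ L : (Fin d → ℝ) →L[ℝ] ℂ,
      HasFDerivAt (fun y => (starRingEnd ℂ) (phi0 A B h sqrtA y)) L x ∧
        ∀ i, L (Pi.single i 1) = -((h : ℂ)⁻¹ * (starRingEnd ℂ) (((B * A⁻¹) *ᵥ cvec x) i) *
          (starRingEnd ℂ) (phi0 A B h sqrtA x)) := by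
  obtain ⟨L, hL, hLi⟩ := exists_hasFDerivAt_quadratic hW x
  have hphi := (((hL.mul_const (((2 * h : ℝ) : ℂ)⁻¹)).fun_neg).cexp).const_mul
    (((Real.pi ^ (-(d : ℝ) / 4) * h ^ (-(d : ℝ) / 4) : ℝ) : ℂ) * sqrtA⁻¹)
  have hconj := Complex.conjCLE.toContinuousLinearMap.hasFDerivAt.comp x hphi
  refine ⟨_, hconj, fun i => ?_⟩
  simp only [phi0, div_eq_mul_inv, ContinuousLinearMap.comp_apply, _root_.smul_apply,
    _root_.neg_apply, hLi, smul_eq_mul, ContinuousLinearEquiv.coe_coe,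
    Complex.conjCLE_apply, map_mul, map_neg, map_inv₀, Complex.conj_ofReal, map_ofNat,
    Complex.ofReal_mul, Complex.ofReal_ofNat, mul_inv]
  ring

/-- Symmetry of `B A⁻¹`, from `Aᵗ B = Bᵗ A`. -/
lemma transpose_mul_inv_eq {d : ℕ} {A B : Matrix (Fin d) (Fin d) ℂ} (hA : IsUnit A.det)
    (hAB : Aᵀ * B - Bᵀ * A = 0) : (B * A⁻¹)ᵀ = B * A⁻¹ := by
  have hAt : IsUnit Aᵀ.det := by rwa [det_transpose]
  rw [transpose_mul, transpose_nonsing_inv]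
  calc Aᵀ⁻¹ * Bᵀ = Aᵀ⁻¹ * (Bᵀ * A) * A⁻¹ := by
        rw [Matrix.mul_assoc, Matrix.mul_assoc, mul_nonsing_inv _ hA, Matrix.mul_one]
    _ = B * A⁻¹ := by
        rw [← sub_eq_zero.mp hAB, nonsing_inv_mul_cancel_left _ _ hAt]

lemma cinner_conj_mulVec {d : ℕ} {W : Matrix (Fin d) (Fin d) ℂ} (hW : Wᵀ = W) (a : Fin d → ℂ)
    (x : Fin d → ℝ) :
    cinner a (fun i => (starRingEnd ℂ) ((W *ᵥ cvec x) i)) = cinner (W *ᵥ a) (cvec x) := by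
  have hdot : a ⬝ᵥ (W *ᵥ cvec x) = (W *ᵥ a) ⬝ᵥ cvec x := by
    rw [dotProduct_mulVec, ← mulVec_transpose, hW]
  simpa [cinner, dotProduct, cvec] using congrArg (starRingEnd ℂ) hdot

lemma phi0_ne_zero {d : ℕ} (A B : Matrix (Fin d) (Fin d) ℂ) {h : ℝ} (hh : 0 < h) {sqrtA : ℂ}
    (hsqrtA : sqrtA ≠ 0) (x : Fin d → ℝ) : phi0 A B h sqrtA x ≠ 0 := by
  have hpos : 0 < Real.pi ^ (-(d : ℝ) / 4) * h ^ (-(d : ℝ) / 4) := by positivity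
  exact mul_ne_zero (mul_ne_zero (Complex.ofReal_ne_zero.mpr hpos.ne') (inv_ne_zero hsqrtA))
    (Complex.exp_ne_zero _)

lemma inv_sqrt_two_mul {h : ℝ} (hh : 0 < h) : (√(2 * h))⁻¹ = √(h / 2) * h⁻¹ := by
  have hmul : √(2 * h) * √(h / 2) = h := by
    rw [← Real.sqrt_mul (by positivity), show 2 * h * (h / 2) = h * h by ring,
      Real.sqrt_mul_self hh.le]
  refine inv_eq_of_mul_eq_one_right ?_
  rw [← mul_assoc, hmul, mul_inv_cancel₀ hh.ne']

/-- Lemma 3.2: for every Schwartz function `ψ`, `1 ≤ l ≤ d` and `x ∈ ℝ^d`,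
`(R_l ψ)(x) = −√(ℏ/2) · (1/conj(φ₀(x))) · ⟨A e_l, ∇(conj(φ₀)·ψ)(x)⟩`. -/
theorem raising_operator_alternative_formula
    {d : ℕ} (hd : 1 ≤ d) {hbar : ℝ} (hhbar : 0 < hbar)
    (A B : Matrix (Fin d) (Fin d) ℂ) (hA : IsUnit A.det) (hB : IsUnit B.det)
    (hAB₁ : Aᴴ * B + Bᴴ * A = (2 : ℂ) • (1 : Matrix (Fin d) (Fin d) ℂ))
    (hAB₂ : Aᵀ * B - Bᵀ * A = 0)
    (sqrtA : ℂ) (hsqrtA : sqrtA ^ 2 = A.det)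
    (ψ : SchwartzMap (Fin d → ℝ) ℂ) (l : Fin d) (x : Fin d → ℝ) :
    raiseOp A B hbar l (⇑ψ) x =
      -((Real.sqrt (hbar / 2) : ℝ) : ℂ) * ((starRingEnd ℂ) (phi0 A B hbar sqrtA x))⁻¹ *
        cinner (A.mulVec (stdC l))
          (grad (fun y => (starRingEnd ℂ) (phi0 A B hbar sqrtA y) * ψ y) x) := by
  have hs : sqrtA ≠ 0 := by
    rintro rfl
    exact hA.ne_zero (by rw [← hsqrtA]; simp)
  have hphi : (starRingEnd ℂ) (phi0 A B hbar sqrtA x) ≠ 0 :=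
    (map_ne_zero _).mpr (phi0_ne_zero A B hhbar hs x)
  have hW := transpose_mul_inv_eq hA hAB₂
  have hh : (hbar : ℂ) ≠ 0 := Complex.ofReal_ne_zero.mpr hhbar.ne'
  have hBl : (B * A⁻¹) *ᵥ (A *ᵥ stdC l) = B *ᵥ stdC l := by
    rw [mulVec_mulVec, nonsing_inv_mul_cancel_right _ _ hA]
  obtain ⟨L, hL, hLi⟩ := exists_hasFDerivAt_conj_phi0 hW hbar sqrtA x
  have hgrad : ∀ i, grad (fun y => (starRingEnd ℂ) (phi0 A B hbar sqrtA y) * ψ y) x i =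
      (starRingEnd ℂ) (phi0 A B hbar sqrtA x) * (grad (⇑ψ) x i -
        (hbar : ℂ)⁻¹ * ψ x * (starRingEnd ℂ) (((B * A⁻¹) *ᵥ cvec x) i)) := by
    intro i
    rw [grad, (hL.fun_mul ψ.differentiableAt.hasFDerivAt).fderiv]
    simp only [_root_.add_apply, _root_.smul_apply, smul_eq_mul, hLi,
      grad]
    ring
  have hpair : cinner (A *ᵥ stdC l)
      (grad (fun y => (starRingEnd ℂ) (phi0 A B hbar sqrtA y) * ψ y) x) =
      (starRingEnd ℂ) (phi0 A B hbar sqrtA x) * (cinner (A *ᵥ stdC l) (grad (⇑ψ) x) -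
        (hbar : ℂ)⁻¹ * ψ x * cinner (B *ᵥ stdC l) (cvec x)) := by
    rw [← hBl, ← cinner_conj_mulVec hW]
    simp only [cinner, hgrad, Finset.mul_sum, ← Finset.sum_sub_distrib]
    exact Finset.sum_congr rfl fun i _ => by ring
  rw [hpair, raiseOp, ← Complex.ofReal_inv, inv_sqrt_two_mul hhbar, Complex.ofReal_mul,
    Complex.ofReal_inv]
  field_simp
  ring

end
end

section
/- The raising operators commute: for all 1 ≤ l, m ≤ d and every smooth function ψ: ℝ^d → ℂ, R_l(R_m ψ) = R_m(R_l ψ). -/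
open Matrix Complex

noncomputable section

theorem mulVec_stdC {d : ℕ} (M : Matrix (Fin d) (Fin d) ℂ) (l : Fin d) :
    M.mulVec (stdC l) = fun j => M j l := by
  ext j
  simp [stdC, Matrix.mulVec_single]

/-- The partial derivatives of `x ↦ ⟨b, x⟩ f(x) - h ⟨a, ∇f(x)⟩`, scaled by `c`. -/
theorem grad_mul_cinner_sub {d : ℕ} (c h : ℂ) (a b : Fin d → ℂ)
    {f : (Fin d → ℝ) → ℂ} (hf : ContDiff ℝ 2 f) (x : Fin d → ℝ) (k : Fin d) :
    grad (fun y => c * (cinner b (cvec y) * f y - h * cinner a (grad f y))) x k =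
      c * ((starRingEnd ℂ) (b k) * f x + cinner b (cvec x) * grad f x k
        - h * cinner a (fun j =>
          fderiv ℝ (fderiv ℝ f) x (Pi.single k 1) (Pi.single j 1))) := by
  have hf' : HasFDerivAt f (fderiv ℝ f x) x :=
    (hf.differentiable (by norm_num) x).hasFDerivAt
  have hf'' : HasFDerivAt (fderiv ℝ f) (fderiv ℝ (fderiv ℝ f) x) x :=
    ((hf.fderiv_right (m := 1) (by norm_num)).differentiable (by norm_num) x).hasFDerivAt
  have hb : HasFDerivAt (fun y : Fin d → ℝ => cinner b (cvec y))
      (∑ j, (starRingEnd ℂ) (b j) •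
        (Complex.ofRealCLM ∘L ContinuousLinearMap.proj (R := ℝ) (φ := fun _ : Fin d => ℝ) j)) x :=
    HasFDerivAt.fun_sum fun j _ =>
      (Complex.ofRealCLM ∘L ContinuousLinearMap.proj (R := ℝ)
        (φ := fun _ : Fin d => ℝ) j).hasFDerivAt.const_mul _
  have ha : HasFDerivAt (fun y : Fin d → ℝ => cinner a (grad f y))
      (∑ j, (starRingEnd ℂ) (a j) •
        (fderiv ℝ (fderiv ℝ f) x).flip (Pi.single j 1)) x := by
    refine HasFDerivAt.fun_sum fun j _ => HasFDerivAt.const_mul ?_ _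
    have := hf''.clm_apply (hasFDerivAt_const (Pi.single j (1 : ℝ)) x)
    rw [ContinuousLinearMap.comp_zero, zero_add] at this
    exact this
  have H := (((hb.mul hf').sub (ha.const_mul h)).const_mul c).fderiv
  have H' := congrArg (fun T => T (Pi.single k (1 : ℝ))) H
  refine H'.trans ?_
  have hs : ∑ j, (starRingEnd ℂ) (b j) * ((Pi.single k (1 : ℝ) : Fin d → ℝ) j : ℂ)
      = (starRingEnd ℂ) (b k) := by
    rw [Finset.sum_eq_single k] <;> simp +contextual
  simp only [_root_.smul_apply, _root_.sub_apply,
    _root_.add_apply, _root_.sum_apply, smul_eq_mul,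
    ContinuousLinearMap.comp_apply, ContinuousLinearMap.proj_apply, Complex.ofRealCLM_apply,
    ContinuousLinearMap.flip_apply, hs]
  simp only [cinner, grad]
  ring

theorem cinner_linear_comb {d : ℕ} (c p q h : ℂ) (a u v w : Fin d → ℂ) :
    cinner a (fun k => c * (u k * p + q * v k - h * w k)) =
      c * (cinner a u * p + q * cinner a v - h * cinner a w) := by
  simp only [cinner, Finset.mul_sum, Finset.sum_mul, ← Finset.sum_add_distrib,
    ← Finset.sum_sub_distrib]
  exact Finset.sum_congr rfl fun k _ => by ring

/-- A symmetric matrix gives a symmetric pairing. -/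
theorem cinner_cinner_comm {d : ℕ} (a b : Fin d → ℂ) {S : Fin d → Fin d → ℂ}
    (hS : ∀ j k, S j k = S k j) :
    cinner a (fun k => cinner b (S k)) = cinner b (fun k => cinner a (S k)) := by
  simp only [cinner, Finset.mul_sum]
  rw [Finset.sum_comm]
  refine Finset.sum_congr rfl fun j _ => Finset.sum_congr rfl fun k _ => ?_
  rw [hS]
  ring

/-- The entries of `AᵗB = BᵗA`, conjugated. -/
theorem cinner_conj_col_comm {d : ℕ} {A B : Matrix (Fin d) (Fin d) ℂ}
    (hAB : Aᵀ * B - Bᵀ * A = 0) (l m : Fin d) :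
    cinner (fun j => A j l) (fun j => (starRingEnd ℂ) (B j m)) =
      cinner (fun j => A j m) (fun j => (starRingEnd ℂ) (B j l)) := by
  have h := congrArg (starRingEnd ℂ) (congrFun (congrFun (sub_eq_zero.mp hAB) l) m)
  simp only [Matrix.mul_apply, Matrix.transpose_apply, map_sum, map_mul] at h
  simp only [cinner]
  rw [h]
  exact Finset.sum_congr rfl fun j _ => mul_comm _ _

/-- The raising operators commute on smooth functions. -/
theorem raising_operators_commute
    {d : ℕ} (hd : 1 ≤ d) {hbar : ℝ} (hhbar : 0 < hbar)
    (A B : Matrix (Fin d) (Fin d) ℂ) (hAB₂ : Aᵀ * B - Bᵀ * A = 0)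
    (l m : Fin d) (ψ : (Fin d → ℝ) → ℂ) (hψ : ContDiff ℝ (⊤ : ℕ∞) ψ) :
    raiseOp A B hbar l (raiseOp A B hbar m ψ) =
      raiseOp A B hbar m (raiseOp A B hbar l ψ) := by
  have hψ2 : ContDiff ℝ 2 ψ := contDiff_infty.mp hψ 2
  funext x
  have hS : ∀ j k : Fin d,
      fderiv ℝ (fderiv ℝ ψ) x (Pi.single j 1) (Pi.single k 1) =
        fderiv ℝ (fderiv ℝ ψ) x (Pi.single k 1) (Pi.single j 1) := fun j k =>
    (hψ2.contDiffAt.isSymmSndFDerivAt (by simp)) _ _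
  have hgrad : ∀ n : Fin d, grad (raiseOp A B hbar n ψ) x = _ := fun n =>
    funext fun k => grad_mul_cinner_sub ((Real.sqrt (2 * hbar) : ℝ) : ℂ)⁻¹ (hbar : ℂ)
      (A.mulVec (stdC n)) (B.mulVec (stdC n)) hψ2 x k
  have hcol := cinner_conj_col_comm hAB₂ l m
  have hsymm := cinner_cinner_comm (fun j => A j l) (fun j => A j m) hS
  simp only [raiseOp] at hgrad ⊢
  rw [hgrad l, hgrad m]
  simp only [cinner_linear_comb, mulVec_stdC]
  rw [hcol, hsymm]
  ring

end
end
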